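/- Let n ≥ 5 be an integer and let S ⊆ V(Q_n) with |S| = k and Type(S) = t, where 0 < 2t ≤ k ≤ 2^{n−1} and t/2^n > 1/24 + 7/64. Then θ(n,S) ≥ 2^n · f(k/2^n), where f(x) = 3/4 − (64/7)(x − 1/2)^2. -/

import Mathlib

open Finset

/-- Two vertices of the hypercube `Q_n` are adjacent iff they differ in exactly one
coordinate. -/
def cubeEdge {n : ℕ} (u v : Fin n → Bool) : Prop :=
  (Finset.univ.filter (fun i => u i ≠ v i)).card = 1

instance {n : ℕ} (u v : Fin n → Bool) : Decidable (cubeEdge u v) := by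
  unfold cubeEdge; infer_instance

/-- `θ(n,S)`: the number of edges of `Q_n` with exactly one endpoint in `S`. -/
def edgeBoundary (n : ℕ) (S : Finset (Fin n → Bool)) : ℕ :=
  (Finset.univ.filter (fun p : (Fin n → Bool) × (Fin n → Bool) =>
    p.1 ∈ S ∧ p.2 ∉ S ∧ cubeEdge p.1 p.2)).card

/-- `θ(n,k) = min {θ(n,S) : S ⊆ V(Q_n), |S| = k}`. -/
noncomputable def thetaMin (n k : ℕ) : ℕ :=
  sInf {m | ∃ S : Finset (Fin n → Bool), S.card = k ∧ edgeBoundary n S = m}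

/-- The half plane `{x : x_i = a}` of `Q_n`. -/
def halfPlane (n : ℕ) (i : Fin n) (a : Bool) : Finset (Fin n → Bool) :=
  Finset.univ.filter (fun x => x i = a)

/-- `Type(S) = min_H |S ∩ H|`, minimum over the `2n` half planes of `Q_n`. -/
noncomputable def typeOf (n : ℕ) (S : Finset (Fin n → Bool)) : ℕ :=
  sInf {m | ∃ (i : Fin n) (a : Bool), (S ∩ halfPlane n i a).card = m}

/-- `θ(n,k,t) = min {θ(n,S) : |S| = k, Type(S) = t}`. -/
noncomputable def thetaMinType (n k t : ℕ) : ℕ :=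
  sInf {m | ∃ S : Finset (Fin n → Bool),
    S.card = k ∧ typeOf n S = t ∧ edgeBoundary n S = m}

/-- Graph distance on the cycle `C_m` with vertices labelled by naturals. -/
def cycleDist (m a b : ℕ) : ℕ := min (Nat.dist a b) (m - Nat.dist a b)

/-- The wirelength of an embedding `η` of `Q_n` into the cycle `C_{2^n}`:
the sum of cycle distances over all (unordered) edges of `Q_n`.  (The sum over
ordered pairs counts every edge twice, whence the division by `2`.) -/
def wirelength (n : ℕ) (η : (Fin n → Bool) → ℕ) : ℕ :=
  ((Finset.univ.filter (fun p : (Fin n → Bool) × (Fin n → Bool) =>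
    cubeEdge p.1 p.2)).sum (fun p => cycleDist (2^n) (η p.1) (η p.2))) / 2

/-- The reflected Gray code embedding `ξ_n(x) = (y)_2 + 1`, where
`y_i = (x_1 + ⋯ + x_i) mod 2`. -/
def xi (n : ℕ) (x : Fin n → Bool) : ℕ :=
  (Finset.univ.sum (fun i : Fin n =>
    ((Finset.univ.filter (fun j : Fin n => j ≤ i ∧ x j = true)).card % 2)
      * 2 ^ (n - 1 - (i : ℕ)))) + 1

/-- `f(x) = 3/4 − (64/7)(x − 1/2)²`. -/
noncomputable def fGuu (x : ℝ) : ℝ := 3/4 - 64/7 * (x - 1/2)^2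

/-- `takDelta i` is `Δ_{i+1}`: `Δ_1(x) = 1/2 − |x − 1/2|`,
`Δ_{n}(x) = (1/2)Δ_{n−1}(2x − ⌊2x⌋)`. -/
noncomputable def takDelta : ℕ → ℝ → ℝ
  | 0, x => 1/2 - |x - 1/2|
  | n+1, x => takDelta n (2*x - (⌊2*x⌋ : ℝ)) / 2

/-- `m_n(x) = Σ_{i=1}^n Δ_i(x)`, the n-th partial sum of the Takagi function. -/
noncomputable def mTakagi (n : ℕ) (x : ℝ) : ℝ := ∑ i ∈ Finset.range n, takDelta i x

/-- `y_N = ⌈2^N/24⌉ / 2^N`. -/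
noncomputable def yGuu (N : ℕ) : ℝ := (⌈(2^N : ℝ)/24⌉ : ℝ) / 2^N

/-- `p_N = 1/2 − y_N`. -/
noncomputable def pGuu (N : ℕ) : ℝ := 1/2 - yGuu N

/-- `g_{n,i,a}^{-1}(S)`, where `g_{n,i,a}` inserts the letter `a` at position `i`. -/
def gPre (n : ℕ) (i : Fin (n+1)) (a : Bool) (S : Finset (Fin (n+1) → Bool)) :
    Finset (Fin n → Bool) :=
  Finset.univ.filter (fun x => i.insertNth a x ∈ S)

def flp {n : ℕ} (i : Fin n) (x : Fin n → Bool) : Fin n → Bool := Function.update x i (!x i)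

def QQ {n : ℕ} (h : (Fin n → Bool) → ℝ) : ℝ := ∑ i, ∑ x, (h x - h (flp i x))^2

def WW {n : ℕ} (h : (Fin n → Bool) → ℝ) (i : Fin n) : ℝ := ∑ x, (if x i then -1 else 1) * h x

def sl {n : ℕ} (h : (Fin (n+1) → Bool) → ℝ) (i : Fin (n+1)) (a : Bool) : (Fin n → Bool) → ℝ :=
  fun x => h (i.insertNth a x)

lemma sum_split {n : ℕ} (i : Fin (n+1)) (F : (Fin (n+1) → Bool) → ℝ) :
    ∑ x, F x = ∑ x : Fin n → Bool, F (i.insertNth false x) + ∑ x : Fin n → Bool, F (i.insertNth true x) := by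
  rw [← (Fin.insertNthEquiv (fun _ => Bool) i).sum_comp, Fintype.sum_prod_type]
  simp [Fin.insertNthEquiv, add_comm]

lemma flp_self {n : ℕ} (i : Fin (n+1)) (a : Bool) (x : Fin n → Bool) :
    flp i (i.insertNth a x : Fin (n+1) → Bool) = i.insertNth (!a) x := by
  unfold flp
  simp

lemma flp_succ {n : ℕ} (i : Fin (n+1)) (j : Fin n) (a : Bool) (x : Fin n → Bool) :
    flp (i.succAbove j) (i.insertNth a x : Fin (n+1) → Bool) = i.insertNth a (flp j x) := by
  unfold flp
  simp [Fin.insertNth_update]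

lemma dir_split {n : ℕ} (i : Fin (n+1)) (h : (Fin (n+1) → Bool) → ℝ) :
    ∑ x, (h x - h (flp i x))^2 = 2 * ∑ x, (sl h i false x - sl h i true x)^2 := by
  rw [sum_split i]
  simp only [flp_self, sl]
  rw [two_mul]
  congr 1
  apply Finset.sum_congr rfl
  intro x _
  simp only [Bool.not_true]
  ring

lemma QQ_split {n : ℕ} (i : Fin (n+1)) (h : (Fin (n+1) → Bool) → ℝ) :
    QQ h = QQ (sl h i false) + QQ (sl h i true) + 2 * ∑ x, (sl h i false x - sl h i true x)^2 := by
  unfold QQ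
  rw [Fin.sum_univ_succAbove _ i, dir_split]
  simp_rw [sum_split i, flp_succ]
  rw [Finset.sum_add_distrib]
  unfold sl
  ring

lemma WW_self {n : ℕ} (i : Fin (n+1)) (h : (Fin (n+1) → Bool) → ℝ) :
    WW h i = ∑ x, sl h i false x - ∑ x, sl h i true x := by
  unfold WW
  rw [sum_split i]
  simp [sl, sub_eq_add_neg]

lemma WW_succ {n : ℕ} (i : Fin (n+1)) (j : Fin n) (h : (Fin (n+1) → Bool) → ℝ) :
    WW h (i.succAbove j) = WW (fun x => sl h i false x + sl h i true x) j := by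
  unfold WW
  rw [sum_split i]
  simp [sl, mul_add, Finset.sum_add_distrib]

lemma QQ_par {n : ℕ} (a b : (Fin n → Bool) → ℝ) :
    2 * (QQ a + QQ b) = QQ (fun x => a x + b x) + QQ (fun x => a x - b x) := by
  unfold QQ
  simp only [mul_add, Finset.mul_sum, ← Finset.sum_add_distrib]
  refine Finset.sum_congr rfl fun i _ => Finset.sum_congr rfl fun x _ => ?_
  ring

lemma sq_par {n : ℕ} (a b : (Fin n → Bool) → ℝ) :
    2 * (∑ x, a x ^2 + ∑ x, b x^2) = ∑ x, (a x + b x)^2 + ∑ x, (a x - b x)^2 := by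
  simp only [mul_add, Finset.mul_sum, ← Finset.sum_add_distrib]
  refine Finset.sum_congr rfl fun x _ => ?_
  ring

lemma QQ_nonneg {n : ℕ} (h : (Fin n → Bool) → ℝ) : 0 ≤ QQ h :=
  Finset.sum_nonneg fun _ _ => Finset.sum_nonneg fun _ _ => sq_nonneg _

lemma poincare : ∀ {n : ℕ} (h : (Fin n → Bool) → ℝ),
    0 ≤ 2^n * QQ h / 4 - 2^n * ∑ x, h x^2 + (∑ x, h x)^2 := by
  intro n
  induction n with
  | zero => intro h; simp [QQ]
  | succ n ih =>
    intro h
    have h1 := QQ_split 0 h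
    have h2 := QQ_par (sl h 0 false) (sl h 0 true)
    have h3 := sq_par (sl h 0 false) (sl h 0 true)
    have h4 := ih (fun x => sl h 0 false x + sl h 0 true x)
    have h5 := QQ_nonneg (fun x => sl h 0 false x - sl h 0 true x)
    have h6 : ∑ x, h x = ∑ x, (sl h 0 false x + sl h 0 true x) := by
      rw [sum_split 0, Finset.sum_add_distrib]; rfl
    have h7 : ∑ x, h x^2 = ∑ x, sl h 0 false x^2 + ∑ x, sl h 0 true x^2 := by
      rw [sum_split 0]; rfl
    have h8 : (0:ℝ) ≤ 2^n * QQ (fun x => sl h 0 false x - sl h 0 true x) := by positivity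
    rw [h6, h7, h1, pow_succ]
    generalize (2:ℝ)^n = N at *
    have e1 := congrArg (N * ·) h2
    have e2 := congrArg (N * ·) h3
    beta_reduce at e1 e2
    linarith

lemma level2 : ∀ {n : ℕ} (h : (Fin n → Bool) → ℝ),
    0 ≤ 2^n * QQ h / 4 - 2 * (2^n * ∑ x, h x^2) + ∑ i, (WW h i)^2 + 2 * (∑ x, h x)^2 := by
  intro n
  induction n with
  | zero => intro h; simp [QQ]
  | succ n ih =>
    intro h
    have h1 := QQ_split 0 h
    have h2 := QQ_par (sl h 0 false) (sl h 0 true)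
    have h3 := sq_par (sl h 0 false) (sl h 0 true)
    have h4 := ih (fun x => sl h 0 false x + sl h 0 true x)
    have h5 := poincare (fun x => sl h 0 false x - sl h 0 true x)
    have h6 : ∑ x, h x = ∑ x, (sl h 0 false x + sl h 0 true x) := by
      rw [sum_split 0, Finset.sum_add_distrib]; rfl
    have h7 : ∑ x, h x^2 = ∑ x, sl h 0 false x^2 + ∑ x, sl h 0 true x^2 := by
      rw [sum_split 0]; rfl
    have h9 : ∑ i, (WW h i)^2 = (∑ x, (sl h 0 false x - sl h 0 true x))^2
        + ∑ i, (WW (fun x => sl h 0 false x + sl h 0 true x) i)^2 := by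
      rw [Fin.sum_univ_succAbove _ 0, WW_self, Finset.sum_sub_distrib]
      simp_rw [WW_succ]
    rw [h9, h6, h7, h1, pow_succ]
    generalize (2:ℝ)^n = N at *
    have e1 := congrArg (N * ·) h2
    have e2 := congrArg (N * ·) h3
    beta_reduce at e1 e2
    linarith

lemma abs_dir {n : ℕ} (a b : (Fin n → Bool) → ℝ) (ha : ∀ x, a x = 0 ∨ a x = 1)
    (hb : ∀ x, b x = 0 ∨ b x = 1) : |∑ x, a x - ∑ x, b x| ≤ ∑ x, (a x - b x)^2 := by
  rw [← Finset.sum_sub_distrib]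
  refine (Finset.abs_sum_le_sum_abs _ _).trans (Finset.sum_le_sum fun x _ => ?_)
  rcases ha x with h | h <;> rcases hb x with h' | h' <;> rw [h, h'] <;> norm_num

lemma sum_WW {n : ℕ} (h : (Fin n → Bool) → ℝ) (hh : ∀ x, h x = 0 ∨ h x = 1) :
    2 * ∑ i, |WW h i| ≤ QQ h := by
  cases n with
  | zero => simp [QQ]
  | succ n =>
    unfold QQ
    rw [Finset.mul_sum]
    refine Finset.sum_le_sum fun i _ => ?_
    rw [dir_split, WW_self]
    have := abs_dir (sl h i false) (sl h i true) (fun x => hh _) (fun x => hh _)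
    linarith

noncomputable def GG (y : ℝ) : ℝ :=
  min (min (2*y) (2*(1-y))) (min (min (y+1/4) (5/4-y)) (1/2 + |y - 1/2|))

lemma GG_le (y : ℝ) : GG y ≤ 2*y ∧ GG y ≤ 2*(1-y) ∧ GG y ≤ y + 1/4 ∧ GG y ≤ 5/4 - y ∧
    GG y ≤ 1/2 + |y-1/2| := by
  unfold GG
  refine ⟨?_, ?_, ?_, ?_, ?_⟩ <;> simp

lemma GG_ch (y : ℝ) : GG y = 2*y ∨ GG y = 2*(1-y) ∨ GG y = y + 1/4 ∨ GG y = 5/4 - y ∨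
    GG y = 1/2 + |y-1/2| := by
  unfold GG
  rcases min_choice (min (2*y) (2*(1-y))) (min (min (y+1/4) (5/4-y)) (1/2 + |y - 1/2|)) with h | h <;> rw [h]
  · rcases min_choice (2*y) (2*(1-y)) with h | h <;> rw [h] <;> simp
  · rcases min_choice (min (y+1/4) (5/4-y)) (1/2 + |y - 1/2|) with h | h <;> rw [h]
    · rcases min_choice (y+1/4) (5/4-y) with h | h <;> rw [h] <;> simp
    · simp

lemma GG_mid (a b : ℝ) (ha0 : 0 ≤ a) (ha1 : a ≤ 1) (hb0 : 0 ≤ b) (hb1 : b ≤ 1) :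
    GG ((a+b)/2) ≤ (GG a + GG b)/2 + |a-b|/2 := by
  obtain ⟨k1, k2, k3, k4, k5⟩ := GG_le ((a+b)/2)
  obtain ⟨p1, p2, p3, p4, p5⟩ := GG_le a
  obtain ⟨q1, q2, q3, q4, q5⟩ := GG_le b
  have d1 := le_abs_self (a-b)
  have d2 := neg_le_abs (a-b)
  have a1 := le_abs_self (a-1/2)
  have a2 := neg_le_abs (a-1/2)
  have b1 := le_abs_self (b-1/2)
  have b2 := neg_le_abs (b-1/2)
  rcases GG_ch a with ha | ha | ha | ha | ha <;> rcases GG_ch b with hb | hb | hb | hb | hb <;>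
    rcases abs_cases ((a+b)/2-1/2) with ⟨m1, m2⟩ | ⟨m1, m2⟩ <;> rw [m1] at k5 <;>
    first | linarith |
     (rcases abs_cases (a-1/2) with ⟨m3, m4⟩ | ⟨m3, m4⟩ <;>
      rcases abs_cases (b-1/2) with ⟨m5, m6⟩ | ⟨m5, m6⟩ <;> rw [m3] at p5 <;> rw [m5] at q5 <;> linarith)

lemma sum_bd {n : ℕ} (h : (Fin n → Bool) → ℝ) (hh : ∀ x, h x = 0 ∨ h x = 1) :
    0 ≤ ∑ x, h x ∧ ∑ x, h x ≤ 2^n := by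
  constructor
  · refine Finset.sum_nonneg fun x _ => ?_
    rcases hh x with h | h <;> rw [h] <;> norm_num
  · have : ∑ x : Fin n → Bool, h x ≤ ∑ x : Fin n → Bool, (1:ℝ) := by
      refine Finset.sum_le_sum fun x _ => ?_
      rcases hh x with h | h <;> rw [h] <;> norm_num
    simpa using this

lemma iso : ∀ {n : ℕ} (h : (Fin n → Bool) → ℝ) (_ : ∀ x, h x = 0 ∨ h x = 1),
    2 * (2^n * GG ((∑ x, h x) / 2^n)) ≤ QQ h := by
  intro n
  induction n with
  | zero =>
    intro h hh
    have e : ∑ x, h x = h (fun i => i.elim0) := by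
      rw [Fintype.sum_eq_single (fun i => i.elim0)]
      intro x hx
      exact absurd (Subsingleton.elim _ _) hx
    have e' : QQ h = 0 := by simp [QQ]
    rw [e, e']
    rcases hh (fun i => i.elim0) with h0 | h0 <;> rw [h0] <;> norm_num [GG]
  | succ n ih =>
    intro h hh
    have h1 := QQ_split 0 h
    have i0 := ih (sl h 0 false) (fun x => hh _)
    have i1 := ih (sl h 0 true) (fun x => hh _)
    have ad := abs_dir (sl h 0 false) (sl h 0 true) (fun x => hh _) (fun x => hh _)
    obtain ⟨c1, c2⟩ := sum_bd (sl h 0 false) (fun x => hh _)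
    obtain ⟨c3, c4⟩ := sum_bd (sl h 0 true) (fun x => hh _)
    have h6 : ∑ x, h x = ∑ x, sl h 0 false x + ∑ x, sl h 0 true x := by
      rw [sum_split 0]; rfl
    rw [h6, h1, pow_succ]
    have hN : (0:ℝ) < 2^n := by positivity
    generalize (2:ℝ)^n = N at *
    generalize ∑ x, sl h 0 false x = A at *
    generalize ∑ x, sl h 0 true x = B at *
    have m := GG_mid (A/N) (B/N) (by positivity) ((div_le_one hN).2 c2) (by positivity) ((div_le_one hN).2 c4)
    have e : (A/N + B/N)/2 = (A+B)/(N*2) := by field_simp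
    have e2 : |A/N - B/N| = |A-B|/N := by rw [← sub_div, abs_div, abs_of_pos hN]
    rw [e, e2] at m
    have m' := mul_le_mul_of_nonneg_left m hN.le
    have e3 : N * ((GG (A / N) + GG (B / N)) / 2 + |A - B| / N / 2)
      = (N * GG (A/N) + N * GG (B/N))/2 + |A-B|/2 := by field_simp
    rw [e3] at m'
    linarith

def ind {n : ℕ} (S : Finset (Fin n → Bool)) : (Fin n → Bool) → ℝ := fun x => if x ∈ S then 1 else 0

lemma flp_flp {n : ℕ} (i : Fin n) (x : Fin n → Bool) : flp i (flp i x) = x := by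
  unfold flp; simp

lemma cubeEdge_iff {n : ℕ} (u v : Fin n → Bool) : cubeEdge u v ↔ ∃ i, flp i u = v := by
  unfold cubeEdge flp
  rw [Finset.card_eq_one]
  refine exists_congr fun i => ?_
  constructor
  · intro h
    have h' : ∀ j, u j ≠ v j ↔ j = i := by
      intro j
      have := congrArg (j ∈ ·) h
      simpa using this
    ext j
    by_cases hj : j = i
    · subst hj
      have := (h' j).2 rfl
      revert this
      cases hu : u j <;> cases hv : v j <;> simp [hu]
    · have := (h' j).not.2 hj
      simp only [ne_eq, not_not] at this
      simp [hj, this]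
  · rintro rfl
    ext j
    by_cases hj : j = i
    · subst hj; simp
    · simp [hj]

lemma eb_eq {n : ℕ} (S : Finset (Fin n → Bool)) : 2 * (edgeBoundary n S : ℝ) = QQ (ind S) := by
  have h1 : edgeBoundary n S =
      ((Finset.univ : Finset (Fin n × (Fin n → Bool))).filter
        (fun p => p.2 ∈ S ∧ flp p.1 p.2 ∉ S)).card := by
    unfold edgeBoundary
    symm
    refine Finset.card_bij (fun p _ => (p.2, flp p.1 p.2)) ?_ ?_ ?_
    · rintro ⟨i, x⟩ hp
      simp only [Finset.mem_filter, Finset.mem_univ, true_and] at hp ⊢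
      exact ⟨hp.1, hp.2, (cubeEdge_iff _ _).2 ⟨i, rfl⟩⟩
    · rintro ⟨i, x⟩ _ ⟨j, y⟩ _ h
      simp only [Prod.mk.injEq] at h
      obtain ⟨rfl, h⟩ := h
      have := congrFun h i
      unfold flp at this
      by_cases hij : i = j
      · rw [hij]
      · simp [hij] at this
    · rintro ⟨u, v⟩ hp
      simp only [Finset.mem_filter, Finset.mem_univ, true_and] at hp
      obtain ⟨i, hi⟩ := (cubeEdge_iff _ _).1 hp.2.2
      refine ⟨(i, u), ?_, ?_⟩
      · simp [hp.1, hi, hp.2.1]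
      · simp [hi]
  have h2 : (edgeBoundary n S : ℝ) = ∑ i, ∑ x, ind S x * (1 - ind S (flp i x)) := by
    rw [h1, Finset.card_filter, ← Finset.univ_product_univ, Finset.sum_product]
    push_cast
    refine Finset.sum_congr rfl fun i _ => Finset.sum_congr rfl fun x _ => ?_
    unfold ind
    by_cases a : x ∈ S <;> by_cases b : flp i x ∈ S <;> simp [a, b]
  rw [h2, QQ, Finset.mul_sum]
  refine Finset.sum_congr rfl fun i _ => ?_
  have h3 : ∑ x, ind S x * (1 - ind S (flp i x)) = ∑ x, ind S (flp i x) * (1 - ind S x) := by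
    have hi : Function.Involutive (flp i) := flp_flp i
    rw [← Equiv.sum_comp hi.toPerm]
    simp only [Function.Involutive.coe_toPerm, flp_flp]
  rw [two_mul]
  nth_rw 2 [h3]
  rw [← Finset.sum_add_distrib]
  refine Finset.sum_congr rfl fun x _ => ?_
  unfold ind
  by_cases a : x ∈ S <;> by_cases b : flp i x ∈ S <;> simp [a, b]

lemma hp_card {n : ℕ} (S : Finset (Fin n → Bool)) (i : Fin n) (a : Bool) :
    ((S ∩ halfPlane n i a).card : ℝ) = ∑ x, (if x i = a then ind S x else 0) := by
  have : S ∩ halfPlane n i a = Finset.univ.filter (fun x => x i = a ∧ x ∈ S) := by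
    ext x; simp [halfPlane, and_comm]
  rw [this, Finset.card_filter]
  push_cast
  refine Finset.sum_congr rfl fun x _ => ?_
  unfold ind
  by_cases h : x i = a <;> by_cases h' : x ∈ S <;> simp [h, h']

lemma hp_sl {n : ℕ} (S : Finset (Fin (n+1) → Bool)) (i : Fin (n+1)) (a : Bool) :
    ((S ∩ halfPlane (n+1) i a).card : ℝ) = ∑ x, sl (ind S) i a x := by
  rw [hp_card, sum_split i]
  cases a <;> simp [sl]

lemma GG_ge (y : ℝ) (h1 : 1/4 ≤ y) (h2 : y ≤ 3/8) : y + 1/4 ≤ GG y := by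
  have := neg_le_abs (y-1/2)
  rcases GG_ch y with h | h | h | h | h <;> rw [h] <;> linarith

lemma GG_symm (y : ℝ) : GG (1-y) = GG y := by
  unfold GG
  have e1 : |1 - y - 1/2| = |y-1/2| := by rw [← abs_neg]; congr 1; ring
  have e2 : 2 * (1 - (1 - y)) = 2 * y := by ring
  have e3 : 1 - y + 1/4 = 5/4 - y := by ring
  have e4 : 5/4 - (1 - y) = y + 1/4 := by ring
  rw [e1, e2, e3, e4, min_comm (2*(1-y)), min_comm (5/4-y)]

/-- Guu, Theorem 16. -/
theorem theta_lower_bound_big_type (n k t : ℕ) (hn : 5 ≤ n)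
    (S : Finset (Fin n → Bool)) (hcard : S.card = k) (htype : typeOf n S = t)
    (ht0 : 0 < 2*t) (h2t : 2*t ≤ k) (hk : k ≤ 2^(n-1))
    (hbig : (t:ℝ)/2^n > 1/24 + 7/64) :
    (edgeBoundary n S : ℝ) ≥ 2^n * fGuu ((k:ℝ)/2^n) := by
  obtain ⟨m, rfl⟩ : ∃ m, n = m + 1 := ⟨n - 1, by omega⟩
  have hh : ∀ x, ind S x = 0 ∨ ind S x = 1 := by
    intro x; unfold ind; by_cases h : x ∈ S <;> simp [h]
  have hsum : ∑ x, ind S x = k := by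
    unfold ind; simp [hcard]
  have hsq : ∑ x, ind S x ^ 2 = k := by
    rw [← hsum]
    refine Finset.sum_congr rfl fun x _ => ?_
    rcases hh x with h | h <;> rw [h] <;> norm_num
  have hge : ∀ i a, (t:ℝ) ≤ ∑ x, sl (ind S) i a x := by
    intro i a
    rw [← hp_sl]
    have : typeOf (m+1) S ≤ (S ∩ halfPlane (m+1) i a).card := Nat.sInf_le ⟨i, a, rfl⟩
    rw [htype] at this
    exact_mod_cast this
  have hspl : ∀ i, ∑ x, sl (ind S) i false x + ∑ x, sl (ind S) i true x = k := by
    intro i; rw [← hsum, sum_split i]; rfl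
  have hex : ∃ i a, ∑ x, sl (ind S) i a x = t := by
    have : t ∈ {m' | ∃ (i : Fin (m+1)) (a : Bool), (S ∩ halfPlane (m+1) i a).card = m'} := by
      rw [← htype]
      exact Nat.sInf_mem ⟨_, 0, false, rfl⟩
    obtain ⟨i, a, h⟩ := this
    exact ⟨i, a, by rw [← hp_sl, h]⟩
  have hq := eb_eq S
  have hkR : (k:ℝ) ≤ 2^m := by
    have : k ≤ 2^m := by simpa using hk
    exact_mod_cast this
  have h2tR : 2*(t:ℝ) ≤ k := by exact_mod_cast h2t
  have hM : (0:ℝ) < 2^m := by positivity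
  have l2 := level2 (ind S)
  have sw := sum_WW (ind S) hh
  have hW : ∑ i, (WW (ind S) i)^2 ≤ ((k:ℝ) - 2*t) * ∑ i, |WW (ind S) i| := by
    rw [Finset.mul_sum]
    refine Finset.sum_le_sum fun i _ => ?_
    rw [← sq_abs, sq]
    refine mul_le_mul_of_nonneg_right ?_ (abs_nonneg _)
    have a1 := hge i false
    have a2 := hge i true
    have a3 := hspl i
    rw [WW_self, abs_le]
    constructor <;> linarith
  have hsp : ∃ A B : ℝ, A = t ∧ B = k - t ∧
      2 * (2^m * GG (A/2^m)) + 2 * (2^m * GG (B/2^m)) + 2 * |A - B| ≤ QQ (ind S) := by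
    obtain ⟨i, a, h⟩ := hex
    have q := QQ_split i (ind S)
    have i0 := iso (sl (ind S) i false) (fun x => hh _)
    have i1 := iso (sl (ind S) i true) (fun x => hh _)
    have ad := abs_dir (sl (ind S) i false) (sl (ind S) i true) (fun x => hh _) (fun x => hh _)
    have a3 := hspl i
    cases a with
    | false => exact ⟨_, _, h, (by linarith), by rw [q]; linarith⟩
    | true =>
      refine ⟨_, _, h, (by linarith : ∑ x, sl (ind S) i false x = _), ?_⟩
      rw [q, abs_sub_comm]; linarith
  obtain ⟨A, B, hA, hB, hAB⟩ := hsp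
  rw [hsum, hsq] at l2
  rw [← hq] at l2 sw hAB
  set θ : ℝ := (edgeBoundary (m+1) S : ℝ)
  have hθ : (0:ℝ) ≤ θ := Nat.cast_nonneg _
  subst hA hB
  have hd := mul_le_mul_of_nonneg_left sw (sub_nonneg.2 h2tR)
  rw [pow_succ] at l2 hbig ⊢
  generalize (2:ℝ)^m = M at *
  -- normalise
  obtain ⟨x, hx⟩ : ∃ x : ℝ, (k:ℝ) = x * (M*2) := ⟨k/(M*2), by field_simp⟩
  obtain ⟨y, hy⟩ : ∃ y : ℝ, (t:ℝ) = y * M := ⟨t/M, by field_simp⟩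
  obtain ⟨q, hqq⟩ : ∃ q : ℝ, θ = q * (M*2) := ⟨θ/(M*2), by field_simp⟩
  have fourier : 4*x*(1-x) ≤ q * (1 + 2*(x-y)) := by
    have : (M*2)^2 * (4*x*(1-x)) ≤ (M*2)^2 * (q * (1 + 2*(x-y))) := by
      rw [hx, hy, hqq] at hd
      rw [hx, hqq] at l2
      rw [hx, hy] at hW
      linarith
    exact le_of_mul_le_mul_left this (by positivity)
  have hy1 : y > 29/96 := by
    rw [hy] at hbig
    have : y * M / (M*2) = y/2 := by field_simp
    rw [this] at hbig
    linarith
  have hx1 : x ≤ 1/2 := by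
    rw [hx] at hkR
    have : x * 2 * M ≤ 1 * M := by linarith
    linarith [le_of_mul_le_mul_right this hM]
  have hyx : y ≤ x := by
    rw [hx, hy] at h2tR
    have : y * M ≤ x * M := by linarith
    exact le_of_mul_le_mul_right this hM
  have hq0 : 0 ≤ q := by
    rw [hqq] at hθ
    exact nonneg_of_mul_nonneg_left hθ (by positivity)
  have split : (GG y + GG (1-2*x+y))/2 + (x-y) ≤ q := by
    have e1 : (t:ℝ)/M = y := by rw [hy]; field_simp
    have e2 : ((k:ℝ)-t)/M = 1 - (1-2*x+y) := by rw [hx, hy]; field_simp; ring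
    rw [e1, e2, GG_symm, hqq] at hAB
    have := neg_le_abs ((t:ℝ) - (k - t))
    have e3 : -((t:ℝ) - (k - t)) = 2*M*(x-y) := by rw [hx, hy]; ring
    rw [e3] at this
    have : M * ((GG y + GG (1-2*x+y))/2 + (x-y)) ≤ M * q := by linarith
    exact le_of_mul_le_mul_left this hM
  have goal' : fGuu x ≤ q := by
    unfold fGuu
    by_cases hc : x - y ≤ 1/6
    · have : q * (1 + 2*(x-y)) ≤ q * (4/3) := mul_le_mul_of_nonneg_left (by linarith) hq0
      nlinarith [sq_nonneg (x-1/2)]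
    · push Not at hc
      have g1 := GG_ge y (by linarith) (by linarith)
      have g2 := GG_ge (1-2*x+y) (by linarith) (by linarith)
      nlinarith [sq_nonneg (x-1/2)]
  have e : (k:ℝ)/(M*2) = x := by rw [hx]; field_simp
  rw [e, hqq, ge_iff_le, mul_comm]
  exact mul_le_mul_of_nonneg_right goal' (by positivity)
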